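/- Let (Ω, μ) be a finite probability space, let n ≥ 2 be a natural number, and let ℐ = (Y_1, …, Y_D) be a family of random variables on Ω with nonempty finite codomains. Let S ⊆ S' ⊆ {1,…,D} be nonempty subsets such that H(Y_k) ≤ min_{i∈S} H(Y_i) for every k ∈ S'∖S, and assume W̄(𝒳_S) > 0 and W̄(𝒳_{S'}) > 0. Then ŵ(S') − t̄̄₀(S', n) ≤ w̄(S) − t̄̄₀(S, n); that is, the bounding function w̄₀̄̄ref(S) = w̄(S) − t̄̄₀(S, n) is an admissible bound for the reliable normalized total correlation ŵ₀̄̄ = ŵ − t̄̄₀ over all low-entropy extensions of S. -/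

import Mathlib

open Real BigOperators
open scoped Classical

/-- The distribution of a random variable `X : Ω → A` under the pmf `μ`. -/
noncomputable def prob {Ω : Type} [Fintype Ω] (μ : Ω → ℝ) {A : Type} [DecidableEq A]
    (X : Ω → A) (a : A) : ℝ :=
  ∑ ω ∈ Finset.univ.filter (fun ω => X ω = a), μ ω

/-- Shannon entropy (natural logarithm, `0 · log 0 = 0`) of a random variable. -/
noncomputable def entropy {Ω : Type} [Fintype Ω] (μ : Ω → ℝ) {A : Type} [Fintype A]
    [DecidableEq A] (X : Ω → A) : ℝ :=
  -∑ a : A, prob μ X a * Real.log (prob μ X a)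

section Subfamily

variable {Ω : Type} [Fintype Ω] {D : ℕ} {A : Fin D → Type}
  [∀ i, Fintype (A i)] [∀ i, DecidableEq (A i)]

/-- Total correlation `W(𝒳_S)` of the subfamily `(Y_i)_{i∈S}`:
`Σ_{i∈S} H(Y_i) − H((Y_i)_{i∈S})`, where the joint entropy is that of the tuple-valued
random variable `ω ↦ (Y_i ω)_{i∈S}`. -/
noncomputable def subW (μ : Ω → ℝ) (Y : ∀ i, Ω → A i) (S : Finset (Fin D)) : ℝ :=
  (∑ i ∈ S, entropy μ (Y i)) -
    entropy μ (fun ω => (fun i : {x // x ∈ S} => Y i.1 ω))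

/-- `W̄(𝒳_S) = Σ_{i∈S} H(Y_i) − max_{i∈S} H(Y_i)`. -/
noncomputable def subWbar (μ : Ω → ℝ) (Y : ∀ i, Ω → A i) (S : Finset (Fin D)) : ℝ :=
  (∑ i ∈ S, entropy μ (Y i)) - ⨆ i : {x // x ∈ S}, entropy μ (Y i.1)

/-- The (plug-in) normalized total correlation `ŵ(S) = W(𝒳_S)/W̄(𝒳_S)`. -/
noncomputable def what (μ : Ω → ℝ) (Y : ∀ i, Ω → A i) (S : Finset (Fin D)) : ℝ :=
  subW μ Y S / subWbar μ Y S

/-- The refinement elements of `S`: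
`R_S = {k ∉ S : H(Y_k) ≤ min_{i∈S} H(Y_i)}`. -/
noncomputable def RS (μ : Ω → ℝ) (Y : ∀ i, Ω → A i) (S : Finset (Fin D)) :
    Finset (Fin D) :=
  Finset.univ.filter (fun k => k ∉ S ∧ ∀ i ∈ S, entropy μ (Y k) ≤ entropy μ (Y i))

/-- The bound `w̄(S) = (W(𝒳_S) + Σ_{k∈R_S} H(Y_k)) / (W̄(𝒳_S) + Σ_{k∈R_S} H(Y_k))`. -/
noncomputable def wbarRef (μ : Ω → ℝ) (Y : ∀ i, Ω → A i) (S : Finset (Fin D)) : ℝ :=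
  (subW μ Y S + ∑ k ∈ RS μ Y S, entropy μ (Y k)) /
    (subWbar μ Y S + ∑ k ∈ RS μ Y S, entropy μ (Y k))

end Subfamily

/-- The numerator of the correction term `t̄̄₀` for a family of `k` variables with domain
sizes `e : Fin k → ℕ` and sample size `n`:
`max_{σ ∈ S_k} Σ_{i=2}^k log((n + Π_{j=1}^i e_{σ(j)})/(n − 1))`
(`0`-indexed: sum over `i ≠ 0`, prefix product over `j ≤ i`). -/
noncomputable def tbbNum (n k : ℕ) (e : Fin k → ℕ) : ℝ :=
  ⨆ σ : Equiv.Perm (Fin k),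
    ∑ i ∈ Finset.univ.filter (fun i : Fin k => i.val ≠ 0),
      Real.log (((n : ℝ) +
          ∏ j ∈ Finset.univ.filter (fun j : Fin k => j ≤ i), (e (σ j) : ℝ)) /
        ((n : ℝ) - 1))

/-- The correction term `t̄̄₀(S, n) = t̄̄₀(𝒳_S, n)` of the subfamily `(Y_i)_{i∈S}`:
the permutation-model correction computed from the domain sizes of the variables in `S`
(enumerated via `S ≃ Fin S.card`), divided by `W̄(𝒳_S)`. -/
noncomputable def tbb0S {Ω : Type} [Fintype Ω] {D : ℕ} {A : Fin D → Type}
    [∀ i, Fintype (A i)] [∀ i, DecidableEq (A i)]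
    (μ : Ω → ℝ) (Y : ∀ i, Ω → A i) (n : ℕ) (S : Finset (Fin D)) : ℝ :=
  tbbNum n S.card (fun i => Fintype.card (A ((S.equivFin.symm i) : Fin D))) /
    subWbar μ Y S


section Entropy

variable {Ω : Type} [Fintype Ω] {μ : Ω → ℝ}

lemma prob_nonneg (hμ : ∀ ω, 0 ≤ μ ω) {A : Type} [DecidableEq A] (X : Ω → A) (a : A) :
    0 ≤ prob μ X a :=
  Finset.sum_nonneg fun ω _ => hμ ω

lemma prob_le_one (hμ : ∀ ω, 0 ≤ μ ω) (hμ1 : ∑ ω, μ ω = 1) {A : Type} [DecidableEq A]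
    (X : Ω → A) (a : A) : prob μ X a ≤ 1 :=
  hμ1 ▸ Finset.sum_le_sum_of_subset_of_nonneg (Finset.filter_subset _ _) fun ω _ _ => hμ ω

lemma entropy_nonneg (hμ : ∀ ω, 0 ≤ μ ω) (hμ1 : ∑ ω, μ ω = 1) {A : Type} [Fintype A]
    [DecidableEq A] (X : Ω → A) : 0 ≤ entropy μ X := by
  rw [entropy, neg_nonneg]
  exact Finset.sum_nonpos fun a _ => mul_nonpos_of_nonneg_of_nonpos (prob_nonneg hμ X a)
    (Real.log_nonpos (prob_nonneg hμ X a) (prob_le_one hμ hμ1 X a))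

lemma prob_comp {A B : Type} [Fintype A] [DecidableEq A] [DecidableEq B] (X : Ω → A)
    (g : A → B) (b : B) :
    prob μ (g ∘ X) b = ∑ a ∈ Finset.univ.filter (fun a => g a = b), prob μ X a := by
  unfold prob
  rw [← Finset.sum_fiberwise_of_maps_to (t := Finset.univ.filter (fun a => g a = b)) (g := X)
    (by simp)]
  refine Finset.sum_congr rfl fun a ha => Finset.sum_congr ?_ fun _ _ => rfl
  ext ω
  simp only [Finset.mem_filter, Finset.mem_univ, true_and, Function.comp] at ha ⊢
  exact ⟨fun h => h.2, fun h => ⟨h ▸ ha, h⟩⟩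

/-- Entropy does not increase under a deterministic map. -/
lemma entropy_comp_le (hμ : ∀ ω, 0 ≤ μ ω) {A B : Type} [Fintype A] [DecidableEq A]
    [Fintype B] [DecidableEq B] (X : Ω → A) (g : A → B) :
    entropy μ (g ∘ X) ≤ entropy μ X := by
  rw [entropy, entropy, neg_le_neg_iff, ← Finset.sum_fiberwise Finset.univ g]
  refine Finset.sum_le_sum fun b _ => ?_
  conv_rhs => rw [prob_comp, Finset.sum_mul, ← prob_comp]
  refine Finset.sum_le_sum fun a ha => ?_
  rcases (prob_nonneg hμ X a).eq_or_lt with h0 | h0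
  · simp [← h0]
  · refine mul_le_mul_of_nonneg_left (Real.log_le_log h0 ?_) h0.le
    rw [prob_comp]
    exact Finset.single_le_sum (f := prob μ X) (fun a _ => prob_nonneg hμ X a) ha

variable {D : ℕ} {A : Fin D → Type} [∀ i, Fintype (A i)] [∀ i, DecidableEq (A i)]
  {Y : ∀ i, Ω → A i} {S S' : Finset (Fin D)}

lemma subW_le_subWbar (hμ : ∀ ω, 0 ≤ μ ω) (hS : S.Nonempty) : subW μ Y S ≤ subWbar μ Y S := by
  have : Nonempty {x // x ∈ S} := hS.to_subtype
  exact sub_le_sub_left (ciSup_le fun i => entropy_comp_le hμ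
    (fun ω => (fun i : {x // x ∈ S} => Y i.1 ω)) (fun f => f i)) _

lemma subW_le_add_of_subset (hμ : ∀ ω, 0 ≤ μ ω) (h : S ⊆ S') :
    subW μ Y S' ≤ subW μ Y S + ∑ k ∈ S' \ S, entropy μ (Y k) := by
  have hmono := entropy_comp_le hμ (fun ω => (fun i : {x // x ∈ S'} => Y i.1 ω))
    (fun f (i : {x // x ∈ S}) => f ⟨i.1, h i.2⟩)
  have hsum := Finset.sum_sdiff (f := fun i => entropy μ (Y i)) h
  simp only [Function.comp_def] at hmono
  unfold subW
  linarith

lemma subWbar_eq_add_of_subset (hS : S.Nonempty) (h : S ⊆ S')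
    (hlow : ∀ k ∈ S' \ S, ∀ i ∈ S, entropy μ (Y k) ≤ entropy μ (Y i)) :
    subWbar μ Y S' = subWbar μ Y S + ∑ k ∈ S' \ S, entropy μ (Y k) := by
  have : Nonempty {x // x ∈ S} := hS.to_subtype
  have : Nonempty {x // x ∈ S'} := (hS.mono h).to_subtype
  have hsup : (⨆ i : {x // x ∈ S'}, entropy μ (Y i.1)) = ⨆ i : {x // x ∈ S}, entropy μ (Y i.1) := by
    have hb : BddAbove (Set.range fun i : {x // x ∈ S} => entropy μ (Y i.1)) :=
      (Set.finite_range _).bddAbove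
    have hb' : BddAbove (Set.range fun i : {x // x ∈ S'} => entropy μ (Y i.1)) :=
      (Set.finite_range _).bddAbove
    refine le_antisymm (ciSup_le fun i => ?_) (ciSup_le fun i => le_ciSup hb' ⟨i.1, h i.2⟩)
    by_cases hi : i.1 ∈ S
    · exact le_ciSup hb ⟨i.1, hi⟩
    · obtain ⟨j, hj⟩ := hS
      exact (hlow i.1 (Finset.mem_sdiff.2 ⟨i.2, hi⟩) j hj).trans (le_ciSup hb ⟨j, hj⟩)
  have hsum := Finset.sum_sdiff (f := fun i => entropy μ (Y i)) h
  unfold subWbar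
  rw [hsup]
  linarith

lemma card_sub_one_mul_le_subWbar (hS : S.Nonempty) {c : ℝ}
    (hc : ∀ i ∈ S, c ≤ entropy μ (Y i)) : ((S.card : ℝ) - 1) * c ≤ subWbar μ Y S := by
  have : Nonempty {x // x ∈ S} := hS.to_subtype
  obtain ⟨j, hj⟩ := exists_eq_ciSup_of_finite (f := fun i : {x // x ∈ S} => entropy μ (Y i.1))
  rw [subWbar, ← hj, ← Finset.add_sum_erase S _ j.2, add_sub_cancel_left,
    ← Nat.cast_pred hS.card_pos, ← Finset.card_erase_of_mem j.2, ← nsmul_eq_mul]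
  exact Finset.card_nsmul_le_sum _ _ _ fun i hi => hc i (Finset.mem_of_mem_erase hi)

end Entropy

section Correction

/-- The sum of the logarithmic correction terms of the sequence `a` over its prefixes of length
at least two. -/
noncomputable def correctionSum (n k : ℕ) (a : Fin k → ℕ) : ℝ :=
  ∑ i ∈ Finset.univ.filter (fun i : Fin k => i.val ≠ 0),
    Real.log (((n : ℝ) + ∏ j ∈ Finset.univ.filter (fun j : Fin k => j ≤ i), (a j : ℝ)) /
      ((n : ℝ) - 1))

variable {n : ℕ}

lemma log_correction_nonneg (hn : 2 ≤ n) {x : ℝ} (hx : 0 ≤ x) :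
    0 ≤ Real.log (((n : ℝ) + x) / ((n : ℝ) - 1)) := by
  have : (2 : ℝ) ≤ n := by exact_mod_cast hn
  refine Real.log_nonneg ((one_le_div (by linarith)).2 (by linarith))

lemma log_correction_mono (hn : 2 ≤ n) {x y : ℝ} (hx : 0 ≤ x) (hxy : x ≤ y) :
    Real.log (((n : ℝ) + x) / ((n : ℝ) - 1)) ≤ Real.log (((n : ℝ) + y) / ((n : ℝ) - 1)) := by
  have : (2 : ℝ) ≤ n := by exact_mod_cast hn
  have h1 : (0 : ℝ) < n - 1 := by linarith
  exact Real.log_le_log (by positivity) (by gcongr)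

lemma card_filter_val_ne_zero {k : ℕ} (hk : 0 < k) :
    ((Finset.univ.filter (fun i : Fin k => i.val ≠ 0)).card : ℝ) = k - 1 := by
  obtain ⟨k, rfl⟩ := Nat.exists_eq_succ_of_ne_zero hk.ne'
  have : Finset.univ.filter (fun i : Fin (k + 1) => i.val ≠ 0) = Finset.univ.erase 0 := by
    ext i
    simp
  rw [this, Finset.card_erase_of_mem (Finset.mem_univ _)]
  simp

lemma correctionSum_nonneg (hn : 2 ≤ n) {k : ℕ} (a : Fin k → ℕ) : 0 ≤ correctionSum n k a :=
  Finset.sum_nonneg fun i _ => log_correction_nonneg hn (by positivity)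

lemma correctionSum_le (hn : 2 ≤ n) {k : ℕ} (hk : 0 < k) (a : Fin k → ℕ) (ha : ∀ i, 1 ≤ a i) :
    correctionSum n k a ≤
      ((k : ℝ) - 1) * Real.log (((n : ℝ) + ∏ j, (a j : ℝ)) / ((n : ℝ) - 1)) := by
  rw [← card_filter_val_ne_zero hk, ← nsmul_eq_mul]
  refine Finset.sum_le_card_nsmul _ _ _ fun i _ => log_correction_mono hn (by positivity) ?_
  exact Finset.prod_le_prod_of_subset_of_one_le (Finset.filter_subset _ _)
    (fun j _ => by positivity) fun j _ _ => by exact_mod_cast ha j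

lemma correctionSum_add_le (hn : 2 ≤ n) {k m : ℕ} (hk : 0 < k) (a : Fin (k + m) → ℕ)
    (ha : ∀ i, 1 ≤ a i) :
    correctionSum n k (fun i => a (Fin.castAdd m i)) +
        m * Real.log (((n : ℝ) + ∏ j : Fin k, (a (Fin.castAdd m j) : ℝ)) / ((n : ℝ) - 1)) ≤
      correctionSum n (k + m) a := by
  unfold correctionSum
  simp only [Finset.sum_filter, Finset.prod_filter, Fin.sum_univ_add, Fin.prod_univ_add]
  refine add_le_add (Finset.sum_le_sum fun i _ => le_of_eq ?_) ?_
  · have h1 : ∀ j : Fin m, ¬ Fin.natAdd k j ≤ Fin.castAdd m i := fun j => by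
      simp [Fin.le_def]; omega
    have h2 : ∀ j : Fin k, Fin.castAdd m j ≤ Fin.castAdd m i ↔ j ≤ i := fun j => Iff.rfl
    simp [h1, h2]
  · calc (m : ℝ) * _ = ∑ _i : Fin m,
          Real.log (((n : ℝ) + ∏ j : Fin k, (a (Fin.castAdd m j) : ℝ)) / ((n : ℝ) - 1)) := by simp
      _ ≤ _ := Finset.sum_le_sum fun i _ => ?_
    have h1 : ∀ j : Fin k, Fin.castAdd m j ≤ Fin.natAdd k i := fun j => by
      simp [Fin.le_def]; omega
    have h2 : (Fin.natAdd k i).val ≠ 0 := by simp; omega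
    rw [if_pos h2]
    simp only [h1, if_true]
    refine log_correction_mono hn (by positivity)
      (le_mul_of_one_le_right (by positivity) ?_)
    refine Finset.one_le_prod fun j _ => ?_
    split_ifs
    · exact_mod_cast ha _
    · exact le_rfl

lemma correctionSum_add_le_of_le (hn : 2 ≤ n) {k l : ℕ} (hk : 0 < k) (hkl : k ≤ l)
    (a : Fin l → ℕ) (ha : ∀ i, 1 ≤ a i) :
    correctionSum n k (fun i => a (Fin.castLE hkl i)) +
        ((l : ℝ) - k) *
          Real.log (((n : ℝ) + ∏ j : Fin k, (a (Fin.castLE hkl j) : ℝ)) / ((n : ℝ) - 1)) ≤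
      correctionSum n l a := by
  obtain ⟨m, rfl⟩ := Nat.exists_eq_add_of_le hkl
  have := correctionSum_add_le hn hk a ha
  rw [Nat.cast_add, add_sub_cancel_left]
  exact this

lemma tbbNum_eq_iSup_correctionSum (n k : ℕ) (e : Fin k → ℕ) :
    tbbNum n k e = ⨆ σ : Equiv.Perm (Fin k), correctionSum n k (fun i => e (σ i)) := rfl

lemma correctionSum_le_tbbNum {k : ℕ} (e : Fin k → ℕ) (σ : Equiv.Perm (Fin k)) :
    correctionSum n k (fun i => e (σ i)) ≤ tbbNum n k e :=
  le_ciSup (f := fun σ : Equiv.Perm (Fin k) => correctionSum n k (fun i => e (σ i)))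
    (Set.finite_range _).bddAbove σ

/-- Any enumeration of a finite set extends to an enumeration of a larger finite set. -/
lemma exists_perm_extending {D : ℕ} {S S' : Finset (Fin D)} (hS : S.Nonempty) (h : S ⊆ S')
    (σ : Equiv.Perm (Fin S.card)) :
    ∃ τ : Equiv.Perm (Fin S'.card), ∀ i, (S'.equivFin.symm
      (τ (Fin.castLE (Finset.card_le_card h) i)) : Fin D) = S.equivFin.symm (σ i) := by
  obtain ⟨d, -⟩ := hS
  let f : Fin S'.card → Fin D := fun i =>
    if hi : i.val < S.card then S.equivFin.symm (σ ⟨i, hi⟩) else d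
  obtain ⟨g, hg⟩ := Finset.exists_equiv_extend_of_card_eq (t := S')
    (s := Finset.univ.filter fun i : Fin S'.card => i.val < S.card) (f := f) (by simp)
    (by
      intro x hx
      simp only [Finset.mem_image, Finset.mem_filter, Finset.mem_univ, true_and] at hx
      obtain ⟨i, hi, rfl⟩ := hx
      simp only [f, hi, dif_pos]
      exact h (Subtype.property _))
    (by
      intro i hi j hj hij
      simp only [Finset.coe_filter, Finset.mem_univ, true_and, Set.mem_ofPred_eq] at hi hj
      simpa [f, hi, hj, Subtype.ext_iff, Fin.ext_iff] using hij)
  refine ⟨g.trans S'.equivFin, fun i => ?_⟩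
  simpa [f] using hg (Fin.castLE (Finset.card_le_card h) i) (by simp)

/-- Enlarging a family multiplies the correction numerator at least by the ratio of the numbers
of correction terms. -/
lemma card_sub_one_mul_tbbNum_le (hn : 2 ≤ n) {D : ℕ} (e : Fin D → ℕ) (he : ∀ i, 1 ≤ e i)
    {S S' : Finset (Fin D)} (hS : S.Nonempty) (h : S ⊆ S') :
    ((S'.card : ℝ) - 1) * tbbNum n S.card (fun i => e (S.equivFin.symm i)) ≤
      ((S.card : ℝ) - 1) * tbbNum n S'.card (fun i => e (S'.equivFin.symm i)) := by
  obtain ⟨σ, hσ⟩ := exists_eq_ciSup_of_finite (f := fun σ : Equiv.Perm (Fin S.card) =>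
    correctionSum n S.card (fun i => e (S.equivFin.symm (σ i))))
  obtain ⟨τ, hτ⟩ := exists_perm_extending hS h σ
  have hcard := Finset.card_le_card h
  have hle := correctionSum_le hn hS.card_pos (fun i => e (S.equivFin.symm (σ i))) fun _ => he _
  have hadd := correctionSum_add_le_of_le hn hS.card_pos hcard
    (fun i => e (S'.equivFin.symm (τ i))) fun _ => he _
  have hmax := correctionSum_le_tbbNum (n := n) (fun i => e (S'.equivFin.symm i)) τ
  simp only [hτ] at hadd
  rw [tbbNum_eq_iSup_correctionSum n S.card, ← hσ]
  have h1 : (0 : ℝ) ≤ (S.card : ℝ) - 1 := by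
    rw [sub_nonneg]; exact_mod_cast hS.card_pos
  have h2 : (0 : ℝ) ≤ (S'.card : ℝ) - S.card := by
    rw [sub_nonneg]; exact_mod_cast hcard
  have h3 := mul_le_mul_of_nonneg_left (hadd.trans hmax) h1
  have h4 := mul_le_mul_of_nonneg_left hle h2
  linarith

lemma tbbNum_nonneg (hn : 2 ≤ n) {k : ℕ} (e : Fin k → ℕ) : 0 ≤ tbbNum n k e :=
  (correctionSum_nonneg hn _).trans (correctionSum_le_tbbNum e 1)

end Correction

section Bounds

variable {Ω : Type} [Fintype Ω] {μ : Ω → ℝ} {D : ℕ} {A : Fin D → Type} [∀ i, Fintype (A i)]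
  [∀ i, DecidableEq (A i)] {Y : ∀ i, Ω → A i} {S S' : Finset (Fin D)}

lemma add_div_add_le_add_div_add {a b x y : ℝ} (hab : a ≤ b) (hb : 0 < b) (hx : 0 ≤ x)
    (hxy : x ≤ y) : (a + x) / (b + x) ≤ (a + y) / (b + y) := by
  rw [div_le_div_iff₀ (by linarith) (by linarith)]
  nlinarith [mul_nonneg (sub_nonneg.2 hab) (sub_nonneg.2 hxy)]

lemma what_le_wbarRef (hμ : ∀ ω, 0 ≤ μ ω) (hμ1 : ∑ ω, μ ω = 1) (hS : S.Nonempty) (h : S ⊆ S')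
    (hlow : ∀ k ∈ S' \ S, ∀ i ∈ S, entropy μ (Y k) ≤ entropy μ (Y i))
    (hWS : 0 < subWbar μ Y S) : what μ Y S' ≤ wbarRef μ Y S := by
  have h0 : 0 ≤ ∑ k ∈ S' \ S, entropy μ (Y k) :=
    Finset.sum_nonneg fun k _ => entropy_nonneg hμ hμ1 (Y k)
  have h1 : ∑ k ∈ S' \ S, entropy μ (Y k) ≤ ∑ k ∈ RS μ Y S, entropy μ (Y k) :=
    Finset.sum_le_sum_of_subset_of_nonneg
      (fun k hk => Finset.mem_filter.2
        ⟨Finset.mem_univ _, (Finset.mem_sdiff.1 hk).2, hlow k hk⟩)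
      fun k _ _ => entropy_nonneg hμ hμ1 (Y k)
  refine le_trans ?_ (add_div_add_le_add_div_add (subW_le_subWbar hμ hS) hWS h0 h1)
  rw [what, subWbar_eq_add_of_subset hS h hlow]
  exact div_le_div_of_nonneg_right (subW_le_add_of_subset hμ h) (by linarith)

lemma tbb0S_le_of_subset [∀ i, Nonempty (A i)] {n : ℕ} (hn : 2 ≤ n) (hS : S.Nonempty)
    (h : S ⊆ S') (hlow : ∀ k ∈ S' \ S, ∀ i ∈ S, entropy μ (Y k) ≤ entropy μ (Y i))
    (hWS : 0 < subWbar μ Y S) (hWS' : 0 < subWbar μ Y S') :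
    tbb0S μ Y n S ≤ tbb0S μ Y n S' := by
  have hnum := card_sub_one_mul_tbbNum_le hn (fun i => Fintype.card (A i))
    (fun i => Fintype.card_pos) hS h
  have hnonneg := tbbNum_nonneg hn fun i => Fintype.card (A ((S.equivFin.symm i) : Fin D))
  have hcard : 1 < S.card := by
    by_contra hc
    obtain ⟨i, rfl⟩ := Finset.card_eq_one.1 (le_antisymm (not_lt.1 hc) hS.card_pos)
    simp [subWbar] at hWS
  have hs : (0 : ℝ) < (S.card : ℝ) - 1 := by
    rw [sub_pos]; exact_mod_cast hcard
  have hW : ((S.card : ℝ) - 1) * subWbar μ Y S' ≤ ((S'.card : ℝ) - 1) * subWbar μ Y S := by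
    have hsum : ∑ k ∈ S' \ S, ((S.card : ℝ) - 1) * entropy μ (Y k) ≤
        (S' \ S).card • subWbar μ Y S :=
      Finset.sum_le_card_nsmul _ _ _ fun k hk => card_sub_one_mul_le_subWbar hS (hlow k hk)
    rw [← Finset.mul_sum, nsmul_eq_mul, Finset.cast_card_sdiff h] at hsum
    rw [subWbar_eq_add_of_subset hS h hlow]
    linarith
  rw [tbb0S, tbb0S, div_le_div_iff₀ hWS hWS']
  refine le_of_mul_le_mul_left ?_ hs
  have h1 := mul_le_mul_of_nonneg_left hW hnonneg
  have h2 := mul_le_mul_of_nonneg_right hnum hWS.le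
  linarith

end Bounds

/-- For nonempty `S ⊆ S' ⊆ {1,…,D}` with `S'` a low-entropy extension of
`S`, `W̄(𝒳_S) > 0`, `W̄(𝒳_{S'}) > 0`, and sample size `n ≥ 2`:
`ŵ(S') − t̄̄₀(S', n) ≤ w̄(S) − t̄̄₀(S, n)`, i.e. the bounding function
`w̄₀̄̄ref(S) = w̄(S) − t̄̄₀(S, n)` is admissible for `ŵ₀̄̄ = ŵ − t̄̄₀`. -/
theorem refined_bound_admissible {Ω : Type} [Fintype Ω] [Nonempty Ω]
    (μ : Ω → ℝ) (hμ0 : ∀ ω, 0 ≤ μ ω) (hμ1 : ∑ ω, μ ω = 1)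
    (n : ℕ) (hn : 2 ≤ n)
    {D : ℕ} {A : Fin D → Type}
    [∀ i, Fintype (A i)] [∀ i, DecidableEq (A i)] [∀ i, Nonempty (A i)]
    (Y : ∀ i, Ω → A i) (S S' : Finset (Fin D))
    (hS : S.Nonempty) (hS' : S'.Nonempty) (hSS' : S ⊆ S')
    (hlow : ∀ k ∈ S' \ S, ∀ i ∈ S, entropy μ (Y k) ≤ entropy μ (Y i))
    (hWS : 0 < subWbar μ Y S) (hWS' : 0 < subWbar μ Y S') :
    what μ Y S' - tbb0S μ Y n S' ≤ wbarRef μ Y S - tbb0S μ Y n S := by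
  exact sub_le_sub (what_le_wbarRef hμ0 hμ1 hS hSS' hlow hWS)
    (tbb0S_le_of_subset hn hS hSS' hlow hWS hWS')
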